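/- Let n ≥ 2 be even and let P = ξ_1·(ξ_1 − ξ_2)(ξ_2 − ξ_3)⋯(ξ_{n−1} − ξ_n) ∈ 𝒞_n. The trace of the ℂ-linear endomorphism of the left ideal L_n = 𝒞_n·e induced by left multiplication by P equals (−1)^{(n−2)/2}·2^{n/2}. -/

import Mathlib

namespace CliffordSpin

open CliffordAlgebra

/-- The quadratic form `Q(x) = x₁² + ⋯ + xₙ²` on `ℂⁿ`. -/
noncomputable def Qf (n : ℕ) : QuadraticForm ℂ (Fin n → ℂ) :=
  QuadraticMap.weightedSumSquares ℂ (fun _ : Fin n => (1 : ℂ))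

/-- The Clifford algebra `𝒞ₙ`. -/
abbrev Cl (n : ℕ) := CliffordAlgebra (Qf n)

/-- The generators `ξᵢ` of `𝒞ₙ` (images of the standard basis vectors). -/
noncomputable def ξ (n : ℕ) (i : Fin n) : Cl n := CliffordAlgebra.ι (Qf n) (Pi.single i 1)

/-- The idempotents `eᵢ = (1/2)(1 + √−1 ξ_{2i−1} ξ_{2i})` and their product
`e = e₁ ⋯ e_r`, `r = ⌊n/2⌋` (indices are 0-based here). -/
noncomputable def eIdem (n : ℕ) : Cl n :=
  ((List.finRange (n / 2)).map fun i : Fin (n / 2) =>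
      (2 : ℂ)⁻¹ • (1 + Complex.I •
        (ξ n ⟨2 * (i : ℕ), by have := i.isLt; omega⟩ *
         ξ n ⟨2 * (i : ℕ) + 1, by have := i.isLt; omega⟩))).prod

/-- The left ideal `Lₙ = 𝒞ₙ·e`, as a ℂ-subspace of `𝒞ₙ`. -/
noncomputable def Ln (n : ℕ) : Submodule ℂ (Cl n) := LinearMap.range (LinearMap.mulRight ℂ (eIdem n))


/-- `P = ξ₁·(ξ₁ − ξ₂)(ξ₂ − ξ₃) ⋯ (ξ_{n−1} − ξₙ)` (0-based indexing),
for `n ≥ 2`. -/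
noncomputable def Pelt' (n : ℕ) (hn : 2 ≤ n) : Cl n :=
  ξ n ⟨0, by omega⟩ *
    ((List.finRange (n - 1)).map fun i : Fin (n - 1) =>
        ξ n ⟨(i : ℕ), by have := i.isLt; omega⟩ -
        ξ n ⟨(i : ℕ) + 1, by have := i.isLt; omega⟩).prod

/-- Left multiplication by `P` preserves the left ideal `Lₙ`. -/
theorem mulLeft_mem_Ln (n : ℕ) (P : Cl n) : ∀ x ∈ Ln n, P * x ∈ Ln n := by
  rintro x ⟨y, rfl⟩
  exact ⟨P * y, by simp [LinearMap.mulRight_apply, mul_assoc]⟩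

/-- The endomorphism of `Lₙ` induced by left multiplication by `P`. -/
noncomputable def lmulLn (n : ℕ) (P : Cl n) : Ln n →ₗ[ℂ] Ln n :=
  (LinearMap.mulLeft ℂ P).restrict (fun x hx => mulLeft_mem_Ln n P x hx)

section Anticommuting

variable {A : Type*} [Ring A] {N : ℕ} {x : ℕ → A}

theorem mul_sub_succ_anticomm (hanti : ∀ i < N, ∀ j < N, i ≠ j → x i * x j = -(x j * x i))
    {i j : ℕ} (hij : i < j) (hj : j + 1 < N) :
    x i * (x j - x (j + 1)) = -((x j - x (j + 1)) * x i) := by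
  rw [mul_sub, sub_mul, hanti i (by omega) j (by omega) (by omega),
    hanti i (by omega) (j + 1) hj (by omega)]
  abel

/-- An even number of consecutive differences commutes with every earlier generator. -/
theorem commute_prod_sub_succ (hanti : ∀ i < N, ∀ j < N, i ≠ j → x i * x j = -(x j * x i))
    {i k : ℕ} (m : ℕ) (hik : i < k) (hk : k + 2 * m < N) :
    Commute (x i) ((List.range' k (2 * m)).map fun j => x j - x (j + 1)).prod := by
  induction m generalizing k with
  | zero => simp
  | succ m ih =>
    rw [show 2 * (m + 1) = 2 * m + 1 + 1 by ring, List.range'_succ, List.range'_succ]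
    simp only [List.map_cons, List.prod_cons, ← mul_assoc]
    refine Commute.mul_right ?_ (ih (by omega) (by omega))
    rw [commute_iff_eq, ← mul_assoc, mul_sub_succ_anticomm hanti hik (by omega), neg_mul, mul_assoc,
      mul_sub_succ_anticomm hanti (j := k + 1) (by omega) (by omega)]
    noncomm_ring

variable [Algebra ℂ A]

/-- A tracial functional vanishes on a product of two anticommuting elements. -/
theorem tracial_mul_eq_zero (T : A →ₗ[ℂ] ℂ) (hT : ∀ a b, T (a * b) = T (b * a)) {a b : A}
    (h : a * b = -(b * a)) : T (a * b) = 0 := by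
  have h1 : T (a * b) = -T (a * b) := by
    conv_lhs => rw [h, map_neg, hT]
  exact self_eq_neg.mp h1

theorem tracial_prod_sub_succ (hsq : ∀ i < N, x i * x i = 1)
    (hanti : ∀ i < N, ∀ j < N, i ≠ j → x i * x j = -(x j * x i))
    (T : A →ₗ[ℂ] ℂ) (hT : ∀ a b, T (a * b) = T (b * a)) {k : ℕ} (m : ℕ) (hk : k + 2 * m < N) :
    T ((List.range' k (2 * m)).map fun j => x j - x (j + 1)).prod = (-1) ^ m * T 1 := by
  induction m generalizing k with
  | zero => simp
  | succ m ih =>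
    rw [show 2 * (m + 1) = 2 * m + 1 + 1 by ring, List.range'_succ, List.range'_succ]
    simp only [List.map_cons, List.prod_cons]
    have ih' := ih (k := k + 1 + 1) (by omega)
    have hc0 := (commute_prod_sub_succ hanti (i := k) (k := k + 1 + 1) m (by omega) (by omega)).eq
    have hc1 :=
      (commute_prod_sub_succ hanti (i := k + 1) (k := k + 1 + 1) m (by omega) (by omega)).eq
    generalize ((List.range' (k + 1 + 1) (2 * m)).map fun j => x j - x (j + 1)).prod = W at *
    have h0 : T (x k * ((x (k + 1) - x (k + 1 + 1)) * W)) = 0 := by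
      refine tracial_mul_eq_zero T hT ?_
      rw [← mul_assoc, mul_sub_succ_anticomm hanti (by omega) (by omega), neg_mul, mul_assoc, hc0,
        mul_assoc]
    have h1 : T (x (k + 1) * (x (k + 1 + 1) * W)) = 0 := by
      refine tracial_mul_eq_zero T hT ?_
      rw [← mul_assoc, hanti _ (by omega) _ (by omega) (by omega), neg_mul, mul_assoc, hc1,
        mul_assoc]
    have h2 : x (k + 1) * (x (k + 1) * W) = W := by
      rw [← mul_assoc, hsq _ (by omega), one_mul]
    rw [sub_mul, map_sub, h0, sub_mul, mul_sub, h2, map_sub, h1, ih']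
    ring

/-- The value of a tracial functional on `x₀ (x₀ - x₁) (x₁ - x₂) ⋯`. -/
theorem tracial_mul_prod_sub_succ (hsq : ∀ i < N, x i * x i = 1)
    (hanti : ∀ i < N, ∀ j < N, i ≠ j → x i * x j = -(x j * x i))
    (T : A →ₗ[ℂ] ℂ) (hT : ∀ a b, T (a * b) = T (b * a)) (m : ℕ) (hm : 2 * m + 1 < N) :
    T (x 0 * ((List.range (2 * m + 1)).map fun j => x j - x (j + 1)).prod) = (-1) ^ m * T 1 := by
  rw [List.range_eq_range', List.range'_succ, List.map_cons, List.prod_cons,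
    ← tracial_prod_sub_succ hsq hanti T hT (k := 0 + 1) m (by omega)]
  have hc := (commute_prod_sub_succ hanti (i := 0) (k := 0 + 1) m (by omega) (by omega)).eq
  generalize ((List.range' (0 + 1) (2 * m)).map fun j => x j - x (j + 1)).prod = W at *
  have h1 : T (x 0 * (x (0 + 1) * W)) = 0 := by
    refine tracial_mul_eq_zero T hT ?_
    rw [← mul_assoc, hanti _ (by omega) _ (by omega) (by omega), neg_mul, mul_assoc, hc,
      mul_assoc]
  rw [sub_mul, mul_sub, map_sub, h1, ← mul_assoc, hsq _ (by omega), one_mul, sub_zero]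

/-- The element `(1/2)(1 + √−1 x_{2i} x_{2i+1})`. -/
noncomputable def pairIdem (x : ℕ → A) (i : ℕ) : A :=
  (2 : ℂ)⁻¹ • (1 + Complex.I • (x (2 * i) * x (2 * i + 1)))

theorem commute_pairIdem (hanti : ∀ i < N, ∀ j < N, i ≠ j → x i * x j = -(x j * x i))
    {i j : ℕ} (hj : j < N) (hi : 2 * i + 1 < N) (h0 : j ≠ 2 * i) (h1 : j ≠ 2 * i + 1) :
    Commute (x j) (pairIdem x i) := by
  have h : Commute (x j) (x (2 * i) * x (2 * i + 1)) := by
    rw [commute_iff_eq, ← mul_assoc, hanti j hj _ (by omega) h0, neg_mul, mul_assoc,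
      hanti j hj _ hi h1]
    noncomm_ring
  exact ((Commute.one_right _).add_right (h.smul_right _)).smul_right _

theorem commute_prod_pairIdem (hanti : ∀ i < N, ∀ j < N, i ≠ j → x i * x j = -(x j * x i))
    {l : List ℕ} (hl : ∀ i ∈ l, 2 * i + 1 < N) {j : ℕ} (hj : j < N) (hjl : j / 2 ∉ l) :
    Commute (x j) (l.map (pairIdem x)).prod := by
  refine Commute.list_prod_right _ _ fun y hy => ?_
  obtain ⟨i, hi, rfl⟩ := List.mem_map.mp hy
  have hne : j / 2 ≠ i := fun h => hjl (h ▸ hi)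
  exact commute_pairIdem hanti hj (hl i hi) (by omega) (by omega)

theorem isIdempotentElem_pairIdem (hsq : ∀ i < N, x i * x i = 1)
    (hanti : ∀ i < N, ∀ j < N, i ≠ j → x i * x j = -(x j * x i)) {i : ℕ} (hi : 2 * i + 1 < N) :
    IsIdempotentElem (pairIdem x i) := by
  have hu : (x (2 * i) * x (2 * i + 1)) * (x (2 * i) * x (2 * i + 1)) = -1 := by
    rw [mul_assoc, ← mul_assoc (x (2 * i + 1)),
      hanti (2 * i + 1) hi (2 * i) (by omega) (by omega), neg_mul, mul_neg, mul_assoc, hsq _ hi,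
      mul_one, hsq _ (by omega)]
  unfold IsIdempotentElem pairIdem
  generalize x (2 * i) * x (2 * i + 1) = u at hu
  have h : (Complex.I • u) * (Complex.I • u) = 1 := by
    rw [smul_mul_smul_comm, Complex.I_mul_I, hu, neg_smul, one_smul, neg_neg]
  generalize Complex.I • u = v at h
  rw [smul_mul_smul_comm, mul_add, add_mul, add_mul, h, one_mul, mul_one, one_mul]
  module

theorem isIdempotentElem_prod_pairIdem (hsq : ∀ i < N, x i * x i = 1)
    (hanti : ∀ i < N, ∀ j < N, i ≠ j → x i * x j = -(x j * x i)) {l : List ℕ} (hnd : l.Nodup)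
    (hl : ∀ i ∈ l, 2 * i + 1 < N) : IsIdempotentElem (l.map (pairIdem x)).prod := by
  induction l with
  | nil => simpa using IsIdempotentElem.one
  | cons i l ih =>
    rw [List.nodup_cons] at hnd
    rw [List.forall_mem_cons] at hl
    rw [List.map_cons, List.prod_cons]
    refine (isIdempotentElem_pairIdem hsq hanti hl.1).mul_of_commute ?_ (ih hnd.2 hl.2)
    have h0 := commute_prod_pairIdem hanti hl.2 (j := 2 * i) (by omega)
      (by rw [show 2 * i / 2 = i by omega]; exact hnd.1)
    have h1 := commute_prod_pairIdem hanti hl.2 (j := 2 * i + 1) (by omega)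
      (by rw [show (2 * i + 1) / 2 = i by omega]; exact hnd.1)
    exact ((Commute.one_left _).add_left ((h0.mul_left h1).smul_left _)).smul_left _

theorem tracial_prod_pairIdem (hanti : ∀ i < N, ∀ j < N, i ≠ j → x i * x j = -(x j * x i))
    (T : A →ₗ[ℂ] ℂ) (hT : ∀ a b, T (a * b) = T (b * a)) {l : List ℕ} (hnd : l.Nodup)
    (hl : ∀ i ∈ l, 2 * i + 1 < N) :
    T (l.map (pairIdem x)).prod = (2⁻¹) ^ l.length * T 1 := by
  induction l with
  | nil => simp
  | cons i l ih =>
    rw [List.nodup_cons] at hnd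
    rw [List.forall_mem_cons] at hl
    have h0 := commute_prod_pairIdem hanti hl.2 (j := 2 * i) (by omega)
      (by rw [show 2 * i / 2 = i by omega]; exact hnd.1)
    have hz : T (x (2 * i) * (x (2 * i + 1) * (l.map (pairIdem x)).prod)) = 0 := by
      refine tracial_mul_eq_zero T hT ?_
      rw [← mul_assoc, hanti _ (by omega) _ hl.1 (by omega), neg_mul, mul_assoc, h0.eq, mul_assoc]
    rw [List.map_cons, List.prod_cons, pairIdem, smul_mul_assoc, add_mul, one_mul, smul_mul_assoc,
      mul_assoc, map_smul, map_add, map_smul, hz, ih hnd.2 hl.2]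
    simp only [smul_eq_mul, List.length_cons]
    ring

end Anticommuting

/-- The generators of `𝒞ₙ` indexed by `ℕ`, extended by zero. -/
noncomputable def gen (n i : ℕ) : Cl n := if h : i < n then ξ n ⟨i, h⟩ else 0

theorem gen_of_lt {n i : ℕ} (h : i < n) : gen n i = ξ n ⟨i, h⟩ := dif_pos h

theorem ξ_mul_self (n : ℕ) (i : Fin n) : ξ n i * ξ n i = 1 := by
  have h : Qf n (Pi.single i 1) = 1 := by
    simp [Qf, QuadraticMap.weightedSumSquares_apply, Pi.single_apply]
  rw [ξ, ι_sq_scalar, h, map_one]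

theorem ξ_anticomm (n : ℕ) {i j : Fin n} (h : i ≠ j) : ξ n i * ξ n j = -(ξ n j * ξ n i) := by
  refine ι_mul_ι_comm_of_isOrtho ?_
  rw [QuadraticMap.isOrtho_def]
  simp only [Qf, QuadraticMap.weightedSumSquares_apply, ← Finset.sum_add_distrib]
  refine Finset.sum_congr rfl fun k _ => ?_
  by_cases hi : k = i
  · subst hi; simp [h]
  · simp [hi]

theorem gen_mul_self (n : ℕ) : ∀ i < n, gen n i * gen n i = 1 := fun i hi => by
  rw [gen_of_lt hi, ξ_mul_self]

theorem gen_anticomm (n : ℕ) :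
    ∀ i < n, ∀ j < n, i ≠ j → gen n i * gen n j = -(gen n j * gen n i) := fun i hi j hj h => by
  rw [gen_of_lt hi, gen_of_lt hj, ξ_anticomm n (by simpa using h)]

theorem eIdem_eq_prod_pairIdem (n : ℕ) :
    eIdem n = ((List.range (n / 2)).map (pairIdem (gen n))).prod := by
  rw [eIdem, ← List.map_coe_finRange_eq_range, List.map_map]
  congr 2
  funext i
  have := i.isLt
  rw [Function.comp_apply, pairIdem, gen_of_lt (by omega), gen_of_lt (by omega)]

theorem Pelt'_eq_gen_mul_prod (n : ℕ) (hn : 2 ≤ n) :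
    Pelt' n hn =
      gen n 0 * ((List.range (n - 1)).map fun j => gen n j - gen n (j + 1)).prod := by
  rw [Pelt', ← List.map_coe_finRange_eq_range, List.map_map, gen_of_lt (by omega)]
  congr 3
  funext i
  have := i.isLt
  rw [Function.comp_apply, gen_of_lt (by omega), gen_of_lt (by omega)]

/-- The basis of `𝒞ₙ` transported from the exterior algebra. -/
noncomputable def basisCl (n : ℕ) : Module.Basis (Finset (Fin n)) ℂ (Cl n) :=
  (Pi.basisFun ℂ (Fin n)).ExteriorAlgebra.map (equivExterior (Qf n)).symm

instance finite_Cl (n : ℕ) : Module.Finite ℂ (Cl n) := Module.Finite.of_basis (basisCl n)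

theorem finrank_Cl (n : ℕ) : Module.finrank ℂ (Cl n) = 2 ^ n := by
  rw [Module.finrank_eq_card_basis (basisCl n), Fintype.card_finset, Fintype.card_fin]

theorem forall_mem_range_half_lt (n : ℕ) : ∀ i ∈ List.range (n / 2), 2 * i + 1 < n := by
  intro i hi
  rw [List.mem_range] at hi
  omega

theorem isIdempotentElem_eIdem (n : ℕ) : IsIdempotentElem (eIdem n) :=
  eIdem_eq_prod_pairIdem n ▸ isIdempotentElem_prod_pairIdem (gen_mul_self n) (gen_anticomm n)
    List.nodup_range (forall_mem_range_half_lt n)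

/-- The dimension of `Lₙ` is the trace of the projection `x ↦ x * e`. -/
theorem finrank_Ln (n : ℕ) : (Module.finrank ℂ (Ln n) : ℂ) = 2⁻¹ ^ (n / 2) * 2 ^ n := by
  have hidem : IsIdempotentElem (LinearMap.mulRight ℂ (eIdem n)) := by
    rw [IsIdempotentElem, Module.End.mul_eq_comp, ← LinearMap.mulRight_mul,
      isIdempotentElem_eIdem n]
  let T : Cl n →ₗ[ℂ] ℂ := LinearMap.trace ℂ (Cl n) ∘ₗ (LinearMap.mul ℂ (Cl n)).flip
  have hT1 : T 1 = 2 ^ n := by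
    change LinearMap.trace ℂ (Cl n) (LinearMap.mulRight ℂ 1) = _
    rw [LinearMap.mulRight_one, LinearMap.trace_id, finrank_Cl]
    push_cast
    rfl
  have hT : ∀ a b, T (a * b) = T (b * a) := fun a b => by
    change LinearMap.trace ℂ (Cl n) (LinearMap.mulRight ℂ (a * b)) =
      LinearMap.trace ℂ (Cl n) (LinearMap.mulRight ℂ (b * a))
    rw [LinearMap.mulRight_mul, LinearMap.mulRight_mul]
    exact LinearMap.trace_mul_comm _ _ _
  have hTe := tracial_prod_pairIdem (gen_anticomm n) T hT List.nodup_range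
    (forall_mem_range_half_lt n)
  rw [← eIdem_eq_prod_pairIdem, List.length_range, hT1] at hTe
  rw [← hTe]
  exact (LinearMap.IsProj.trace (LinearMap.IsIdempotentElem.isProj_range _ hidem)).symm

/-- The representation of `𝒞ₙ` on `Lₙ` by left multiplication, as a linear map. -/
noncomputable def lmulLnLinear (n : ℕ) : Cl n →ₗ[ℂ] Module.End ℂ (Ln n) where
  toFun := lmulLn n
  map_add' a b := by ext y; exact add_mul a b (y : Cl n)
  map_smul' c a := by ext y; exact smul_mul_assoc c a (y : Cl n)

theorem lmulLn_mul (n : ℕ) (a b : Cl n) : lmulLn n (a * b) = lmulLn n a * lmulLn n b := by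
  ext y; exact mul_assoc a b (y : Cl n)

theorem lmulLn_one (n : ℕ) : lmulLn n 1 = 1 := by
  ext y; exact one_mul (y : Cl n)

/-- for even `n ≥ 2`, the trace on `Lₙ = 𝒞ₙ·e` of left
multiplication by `P = ξ₁(ξ₁ − ξ₂) ⋯ (ξ_{n−1} − ξₙ)` is
`(−1)^((n−2)/2) · 2^(n/2)`. -/
theorem trace_lmul_Pelt' (n : ℕ) (hn : 2 ≤ n) (heven : Even n) :
    LinearMap.trace ℂ (Ln n) (lmulLn n (Pelt' n hn)) =
      (-1 : ℂ) ^ ((n - 2) / 2) * 2 ^ (n / 2) := by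
  obtain ⟨m, hm⟩ : ∃ m, n = 2 * m + 2 := ⟨(n - 2) / 2, by obtain ⟨k, rfl⟩ := heven; omega⟩
  have hT : ∀ a b, (LinearMap.trace ℂ (Ln n) ∘ₗ lmulLnLinear n) (a * b) =
      (LinearMap.trace ℂ (Ln n) ∘ₗ lmulLnLinear n) (b * a) := fun a b => by
    change LinearMap.trace ℂ (Ln n) (lmulLn n (a * b)) = LinearMap.trace ℂ (Ln n) (lmulLn n (b * a))
    rw [lmulLn_mul, lmulLn_mul, LinearMap.trace_mul_comm]
  have h := tracial_mul_prod_sub_succ (gen_mul_self n) (gen_anticomm n) _ hT m (by omega)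
  rw [show 2 * m + 1 = n - 1 by omega, ← Pelt'_eq_gen_mul_prod n hn] at h
  refine h.trans ?_
  change _ * LinearMap.trace ℂ (Ln n) (lmulLn n 1) = _
  rw [lmulLn_one, LinearMap.trace_one, finrank_Ln, show (n - 2) / 2 = m by omega,
    show n / 2 = m + 1 by omega, show n = (m + 1) + (m + 1) by omega, pow_add 2, ← mul_assoc (2⁻¹ ^ _),
    ← mul_pow, inv_mul_cancel₀ two_ne_zero, one_pow, one_mul]

end CliffordSpin
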